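/- For every positive integer n, the number of 132-avoiding involutions of length n that have a unique longest increasing subsequence equals the number of sequences of n+1 steps, each step being +1 or −1, such that every nonempty prefix and every nonempty suffix of the sequence has strictly positive sum (bidirectional ballot sequences of length n+1). -/

import Mathlib

/-- `s` is the index set of an increasing subsequence of the word `f`. -/
def IsIncSubseq {n : ℕ} {α : Type*} [Preorder α] (f : Fin n → α) (s : Finset (Fin n)) : Prop :=
  ∀ i ∈ s, ∀ j ∈ s, i < j → f i < f j

/-- `f` has a unique longest increasing subsequence. -/
def HasULIS {n : ℕ} {α : Type*} [Preorder α] (f : Fin n → α) : Prop :=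
  ∃! s : Finset (Fin n), IsIncSubseq f s ∧
    ∀ t : Finset (Fin n), IsIncSubseq f t → t.card ≤ s.card

/-- `p` contains the pattern `q`. -/
def Contains {k n : ℕ} (q : Equiv.Perm (Fin k)) (p : Equiv.Perm (Fin n)) : Prop :=
  ∃ f : Fin k → Fin n, StrictMono f ∧ ∀ a b : Fin k, p (f a) < p (f b) ↔ q a < q b

/-- `p` avoids the pattern `q`. -/
def Avoids {k n : ℕ} (q : Equiv.Perm (Fin k)) (p : Equiv.Perm (Fin n)) : Prop :=
  ¬ Contains q p

def pattern321 : Equiv.Perm (Fin 3) := ⟨![2,1,0], ![2,1,0], by decide, by decide⟩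
def pattern231 : Equiv.Perm (Fin 3) := ⟨![1,2,0], ![2,0,1], by decide, by decide⟩
def pattern132 : Equiv.Perm (Fin 3) := ⟨![0,2,1], ![0,2,1], by decide, by decide⟩
def pattern123 : Equiv.Perm (Fin 3) := Equiv.refl (Fin 3)

/-- the number of `q`-avoiding permutations of length `n` with a unique
longest increasing subsequence. -/
noncomputable def uNum {k : ℕ} (q : Equiv.Perm (Fin k)) (n : ℕ) : ℕ :=
  Nat.card {p : Equiv.Perm (Fin n) // Avoids q p ∧ HasULIS ⇑p}

/-- the number of `q`-avoiding involutions of length `n` with a unique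
longest increasing subsequence. -/
noncomputable def iNum {k : ℕ} (q : Equiv.Perm (Fin k)) (n : ℕ) : ℕ :=
  Nat.card {p : Equiv.Perm (Fin n) // p⁻¹ = p ∧ Avoids q p ∧ HasULIS ⇑p}

/-- A permutation is indecomposable if it cannot be cut into a (nonempty) prefix and
a (nonempty) suffix so that every entry of the prefix is smaller than every entry
of the suffix. -/
def Indecomposable {m : ℕ} (w : Equiv.Perm (Fin m)) : Prop :=
  ¬ ∃ j : ℕ, 1 ≤ j ∧ j < m ∧ ∀ a b : Fin m, (a : ℕ) < j → j ≤ (b : ℕ) → w a < w b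

/-- The arcs of an involution are pairwise non-crossing and cover no fixed point. -/
structure IsOpenMatching {n : ℕ} (τ : Equiv.Perm (Fin n)) : Prop where
  invol : ∀ t, τ (τ t) = t
  nested : ∀ a b, a < b → b < τ a → τ b ≠ b ∧ a < τ b ∧ τ b < τ a

/-- The order in which right ends of arcs come first, in increasing order, followed by all
other points, in decreasing order. -/
def LabelLT {n : ℕ} (τ : Equiv.Perm (Fin n)) (s t : Fin n) : Prop :=
  (τ s < s ∧ ¬ τ t < t) ∨ (τ s < s ∧ τ t < t ∧ s < t) ∨ (¬ τ s < s ∧ ¬ τ t < t ∧ t < s)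

/-- The order on the entries of an involution that shuffles its exceedances, in increasing
order, with the other entries, in decreasing order. -/
def TimeLT {n : ℕ} (p : Equiv.Perm (Fin n)) (x y : Fin n) : Prop :=
  (x < p x ∧ y < p y ∧ x < y) ∨ (¬ x < p x ∧ ¬ y < p y ∧ y < x) ∨
    (¬ x < p x ∧ y < p y ∧ ∃ a, a ≤ y ∧ p a ≤ x) ∨
    (x < p x ∧ ¬ y < p y ∧ ∀ a, a ≤ x → y < p a)

/-- `e` conjugates `τ` to `p` and carries the label order of `τ` to the usual order. -/
structure Relabels {n : ℕ} (τ p e : Equiv.Perm (Fin n)) : Prop where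
  conj : ∀ t, e (τ t) = p (e t)
  lt_iff : ∀ s t, LabelLT τ s t ↔ e s < e t

theorem avoids_pattern132_iff {n : ℕ} (p : Equiv.Perm (Fin n)) :
    Avoids pattern132 p ↔ ∀ a b c, a < b → b < c → p a < p c → ¬ p c < p b := by
  constructor
  · intro h a b c hab hbc hac hcb
    refine h ⟨![a, b, c], ?_, ?_⟩
    · intro i j hij
      fin_cases i <;> fin_cases j <;> simp_all [pattern132]
      exact hab.trans hbc
    · intro i j
      have := hac.trans hcb
      fin_cases i <;> fin_cases j <;>
        simp_all [pattern132, le_of_lt]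
  · rintro h ⟨f, hf, hq⟩
    exact h (f 0) (f 1) (f 2) (hf (by decide)) (hf (by decide))
      ((hq 0 2).2 (by decide)) ((hq 2 1).2 (by decide))

theorem exists_perm_lt_iff_of_isStrictTotalOrder {n : ℕ} (r : Fin n → Fin n → Prop)
    (hi : ∀ a, ¬ r a a) (ht : ∀ a b c, r a b → r b c → r a c) (hr : ∀ a b, r a b ∨ a = b ∨ r b a) :
    ∃ e : Equiv.Perm (Fin n), ∀ i j, r i j ↔ e i < e j := by
  classical
  have hmono : ∀ i j, r i j →
      (Finset.univ.filter (fun k => r k i)).card < (Finset.univ.filter (fun k => r k j)).card := by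
    intro i j hij
    apply Finset.card_lt_card
    rw [Finset.ssubset_iff_of_subset]
    · exact ⟨i, by simp [hij], by simp [hi]⟩
    · intro k
      simp only [Finset.mem_filter, Finset.mem_univ, true_and]
      exact fun h => ht _ _ _ h hij
  have hlt : ∀ i, (Finset.univ.filter (fun k => r k i)).card < n := by
    intro i
    conv_rhs => rw [← Finset.card_fin n]
    apply Finset.card_lt_card
    rw [Finset.ssubset_iff_of_subset (Finset.subset_univ _)]
    exact ⟨i, by simp, by simp [hi]⟩
  let g : Fin n → Fin n := fun i => ⟨_, hlt i⟩
  have hg : ∀ i j, r i j ↔ g i < g j := by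
    intro i j
    refine ⟨hmono i j, fun h => ?_⟩
    rcases hr i j with h' | rfl | h'
    · exact h'
    · exact absurd h (lt_irrefl _)
    · exact absurd h (lt_asymm (hmono j i h'))
  have hinj : Function.Injective g := by
    intro i j hij
    rcases hr i j with h' | h' | h'
    · exact absurd ((hg _ _).1 h') (by simp [hij])
    · exact h'
    · exact absurd ((hg _ _).1 h') (by simp [hij])
  exact ⟨Equiv.ofBijective g (Finite.injective_iff_bijective.1 hinj), hg⟩

theorem perm_eq_of_lt_iff {n : ℕ} {e e' : Equiv.Perm (Fin n)}
    (h : ∀ s t, e s < e t ↔ e' s < e' t) : e = e' := by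
  have hm : StrictMono (e.symm.trans e') := by
    intro a b hab
    have := (h (e.symm a) (e.symm b)).1 (by simpa using hab)
    simpa using this
  have h1 : (hm.orderIsoOfSurjective _ (e.symm.trans e').surjective) = OrderIso.refl (Fin n) :=
    Subsingleton.elim _ _
  ext1 t
  have h2 := congrArg (fun o => o (e t)) h1
  simpa using h2.symm

theorem exists_relabels_of_isOpenMatching {n : ℕ} {τ : Equiv.Perm (Fin n)}
    (hτ : IsOpenMatching τ) :
    ∃ p e : Equiv.Perm (Fin n), Relabels τ p e ∧ p⁻¹ = p ∧ Avoids pattern132 p := by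
  obtain ⟨e, he⟩ := exists_perm_lt_iff_of_isStrictTotalOrder (LabelLT τ)
    (by unfold LabelLT; grind) (by unfold LabelLT; grind) (by unfold LabelLT; grind)
  refine ⟨(e.symm.trans τ).trans e, e, ⟨by simp, he⟩, ?_, ?_⟩
  · rw [inv_eq_iff_mul_eq_one]
    ext1 x
    simp [hτ.invol]
  · rw [avoids_pattern132_iff]
    intro a b c
    obtain ⟨x, rfl⟩ := e.surjective a
    obtain ⟨y, rfl⟩ := e.surjective b
    obtain ⟨z, rfl⟩ := e.surjective c
    simp only [Equiv.trans_apply, Equiv.symm_apply_apply, ← he]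
    have h1 := hτ.invol
    have h2 := hτ.nested
    unfold LabelLT
    simp only [h1]
    intro hxy hyz hxz hzy
    have a1 := h2 x y
    have a2 := h2 y x
    have a3 := h2 x z
    have a4 := h2 z x
    have a5 := h2 y z
    have a6 := h2 z y
    have b1 := h2 (τ x) (τ y)
    have b2 := h2 (τ y) (τ x)
    have b3 := h2 (τ x) (τ z)
    have b4 := h2 (τ z) (τ x)
    have b5 := h2 (τ y) (τ z)
    have b6 := h2 (τ z) (τ y)
    have c1 := h2 (τ y) z
    have c2 := h2 z (τ y)
    simp only [h1] at *
    grind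

theorem lt_of_exceedance_of_avoids {n : ℕ} {p : Equiv.Perm (Fin n)} (hp : ∀ x, p (p x) = x)
    (ha : ∀ a b c, a < b → b < c → p a < p c → ¬ p c < p b) {x v : Fin n}
    (hx : x < p x) (hv : ¬ v < p v) : x < v := by
  by_contra h
  have hne : x ≠ v := by rintro rfl; exact hv hx
  have := ha (p v) x (p x)
  simp only [hp] at this
  grind

theorem exists_relabels_of_avoids {n : ℕ} {p : Equiv.Perm (Fin n)} (hinv : p⁻¹ = p)
    (hav : Avoids pattern132 p) :
    ∃ τ e : Equiv.Perm (Fin n), Relabels τ p e ∧ IsOpenMatching τ := by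
  have hp : ∀ x, p (p x) = x := fun x => by
    have := congrArg (fun q : Equiv.Perm (Fin n) => q (p x)) hinv
    simpa using this.symm
  rw [avoids_pattern132_iff] at hav
  have hop : ∀ x v, x < p x → ¬ v < p v → x < v :=
    fun x v => lt_of_exceedance_of_avoids hp hav
  obtain ⟨d, hd⟩ := exists_perm_lt_iff_of_isStrictTotalOrder (TimeLT p)
    (by unfold TimeLT; grind)
    (by
      unfold TimeLT
      intro a b c h1 h2
      by_cases ha : a < p a <;> by_cases hb : b < p b <;> by_cases hc : c < p c <;>
        simp only [ha, hb, hc, true_and, false_and, false_or, or_false,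
          not_true, not_false_eq_true] at * <;> grind)
    (by
      unfold TimeLT
      intro a b
      by_cases ha : a < p a <;> by_cases hb : b < p b <;>
        simp only [ha, hb, true_and, false_and, false_or, or_false,
          not_true, not_false_eq_true] at * <;> grind)
  have hD : ∀ x, d (p x) < d x ↔ x < p x := by
    intro x
    rw [← hd]
    unfold TimeLT
    simp only [hp]
    grind
  refine ⟨(d.symm.trans p).trans d, d.symm, ⟨by simp, ?_⟩, ⟨by simp [hp], ?_⟩⟩
  · intro s t
    obtain ⟨x, rfl⟩ := d.surjective s
    obtain ⟨y, rfl⟩ := d.surjective t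
    unfold LabelLT
    simp only [Equiv.trans_apply, Equiv.symm_apply_apply, hD, ← hd]
    have := hop x y
    have := hop y x
    unfold TimeLT
    by_cases ha : x < p x <;> by_cases hb : y < p y <;>
        simp only [ha, hb, true_and, false_and, false_or, or_false,
          not_true, not_false_eq_true] at * <;> grind
  · intro a b
    obtain ⟨a, rfl⟩ := d.surjective a
    obtain ⟨b, rfl⟩ := d.surjective b
    simp only [Equiv.trans_apply, Equiv.symm_apply_apply, ne_eq, EmbeddingLike.apply_eq_iff_eq]
    intro h1 h2
    obtain ⟨x, rfl⟩ := p.surjective a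
    rw [hp] at *
    have hx := (hD x).1 (h1.trans h2)
    simp only [← hd] at h1 h2 ⊢
    have hpx : ¬ p x < p (p x) := by rw [hp]; exact lt_asymm hx
    by_cases hb : b < p b
    · have hpb : ¬ p b < p (p b) := by rw [hp]; exact lt_asymm hb
      simp only [TimeLT, hx, hb, hpx, hpb, true_and, false_and, false_or, or_false,
        not_true, not_false_eq_true] at h1 h2 ⊢
      obtain ⟨y, hy, hyx⟩ := h1
      refine ⟨hb.ne', ?_, b, h2.le, le_rfl⟩
      by_contra hc
      have h3 := hav y b x
      have : p y ≠ p x := fun h => by have := p.injective h; grind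
      have : p x ≠ p b := fun h => by have := p.injective h; grind
      have : y ≠ b := by rintro rfl; grind
      grind
    · simp only [TimeLT, hx, hb, hpx, true_and, false_and, false_or, or_false,
        not_true, not_false_eq_true] at h1 h2 ⊢
      obtain ⟨y, hy, hyb⟩ := h2
      have hxb := hop x b hx hb
      have hyx : y ≠ x := by rintro rfl; grind
      have hbf : p b ≠ b := by
        intro hbf
        have h3 := hav y x b
        have : p y ≠ p b := fun h => by have := p.injective h; grind
        grind
      have hpb : p b < p (p b) := by rw [hp]; grind
      simp only [hpb, true_and, not_true, false_and, or_false, false_or]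
      refine ⟨hbf, ⟨p b, le_rfl, by rw [hp]; exact h1.le⟩, ?_⟩
      by_contra hc
      have h3 := hav y x (p b)
      rw [hp] at *
      have : p b ≠ x := by rintro rfl; grind
      have : p y ≠ b := by rintro rfl; grind
      grind

theorem Relabels.exceedance_iff {n : ℕ} {τ p e : Equiv.Perm (Fin n)} (h : Relabels τ p e)
    (hτ : IsOpenMatching τ) (t : Fin n) : e t < p (e t) ↔ τ t < t := by
  rw [← h.conj, ← h.lt_iff]
  have := hτ.invol t
  unfold LabelLT
  grind

theorem Relabels.timeLT {n : ℕ} {τ p e : Equiv.Perm (Fin n)} (h : Relabels τ p e)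
    (hτ : IsOpenMatching τ) {s t : Fin n} (hst : s < t) : TimeLT p (e s) (e t) := by
  have hinv := hτ.invol
  unfold TimeLT
  simp only [h.exceedance_iff hτ, ← h.lt_iff]
  by_cases hs : τ s < s <;> by_cases ht : τ t < t <;>
    simp only [hs, ht, true_and, false_and, false_or, or_false,
      not_true, not_false_eq_true]
  · unfold LabelLT; grind
  · intro a ha
    obtain ⟨r, rfl⟩ := e.surjective a
    rw [← h.conj, ← h.lt_iff]
    rw [← not_lt, ← h.lt_iff] at ha
    have := hinv r
    unfold LabelLT at *
    grind
  · have key : ∃ r, τ r < r ∧ r ≤ t ∧ s ≤ τ r := by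
      by_cases h1 : s ≤ τ t
      · exact ⟨t, ht, le_rfl, h1⟩
      · have := hτ.nested (τ t) s
        simp only [hinv] at this
        have := hinv s
        exact ⟨τ s, by grind⟩
    obtain ⟨r, h1, h2, h3⟩ := key
    refine ⟨e r, ?_, ?_⟩
    · rw [← not_lt, ← h.lt_iff]
      unfold LabelLT; grind
    · rw [← h.conj, ← not_lt, ← h.lt_iff]
      have := hinv r
      unfold LabelLT; grind
  · unfold LabelLT; grind

theorem timeLT_asymm {n : ℕ} {p : Equiv.Perm (Fin n)} {x y : Fin n} (h : TimeLT p x y) :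
    ¬ TimeLT p y x := by
  unfold TimeLT at *
  by_cases ha : x < p x <;> by_cases hb : y < p y <;>
    simp only [ha, hb, true_and, false_and, false_or, or_false,
      not_true, not_false_eq_true] at * <;>
    grind

theorem Relabels.timeLT_iff {n : ℕ} {τ p e : Equiv.Perm (Fin n)} (h : Relabels τ p e)
    (hτ : IsOpenMatching τ) (s t : Fin n) : TimeLT p (e s) (e t) ↔ s < t := by
  refine ⟨fun h1 => ?_, h.timeLT hτ⟩
  rcases lt_trichotomy s t with h2 | rfl | h2
  · exact h2
  · exact absurd h1 (timeLT_asymm h1)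
  · exact absurd h1 (timeLT_asymm (h.timeLT hτ h2))

theorem Relabels.matching_unique {n : ℕ} {τ τ' p e e' : Equiv.Perm (Fin n)}
    (h : Relabels τ p e) (h' : Relabels τ' p e') (hτ : IsOpenMatching τ)
    (hτ' : IsOpenMatching τ') : τ = τ' := by
  have he : e.symm = e'.symm := perm_eq_of_lt_iff fun x y => by
    rw [← h.timeLT_iff hτ, ← h'.timeLT_iff hτ']; simp
  have he : e = e' := by simpa using congrArg Equiv.symm he
  subst he
  ext1 t
  exact e.injective (by rw [h.conj, h'.conj])

theorem Relabels.perm_unique {n : ℕ} {τ p p' e e' : Equiv.Perm (Fin n)}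
    (h : Relabels τ p e) (h' : Relabels τ p' e') : p = p' := by
  have he : e = e' := perm_eq_of_lt_iff fun s t => by rw [← h.lt_iff, ← h'.lt_iff]
  subst he
  ext1 x
  obtain ⟨t, rfl⟩ := e.surjective x
  rw [← h.conj, ← h'.conj]

theorem card_eq_of_rel {α β : Type*} (R : α → β → Prop) (h1 : ∀ a, ∃ b, R a b)
    (h2 : ∀ b, ∃ a, R a b) (h3 : ∀ a b b', R a b → R a b' → b = b')
    (h4 : ∀ a a' b, R a b → R a' b → a = a') : Nat.card α = Nat.card β := by
  choose f hf using h1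
  refine Nat.card_eq_of_bijective f ⟨fun a a' h => h4 a a' (f a) (hf a) (h ▸ hf a'), fun b => ?_⟩
  obtain ⟨a, ha⟩ := h2 b
  exact ⟨a, h3 _ _ _ (hf a) ha⟩

/-- The number of entries above and to the right of the entry at `x`. -/
def largerToRight {n : ℕ} (p : Equiv.Perm (Fin n)) (x : Fin n) : Finset (Fin n) :=
  Finset.univ.filter fun y => x < y ∧ p x < p y

theorem isIncSubseq_insert_largerToRight {n : ℕ} {p : Equiv.Perm (Fin n)}
    (hp : Avoids pattern132 p) (x : Fin n) : IsIncSubseq p (insert x (largerToRight p x)) := by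
  rw [avoids_pattern132_iff] at hp
  intro i hi j hj hij
  simp only [largerToRight, Finset.mem_insert, Finset.mem_filter, Finset.mem_univ, true_and]
    at hi hj
  have := hp x i j
  have : p i ≠ p j := fun h => hij.ne (p.injective h)
  grind

theorem card_insert_largerToRight {n : ℕ} (p : Equiv.Perm (Fin n)) (x : Fin n) :
    (insert x (largerToRight p x)).card = (largerToRight p x).card + 1 :=
  Finset.card_insert_of_notMem (by simp [largerToRight])

theorem IsIncSubseq.subset_insert_largerToRight {n : ℕ} {p : Equiv.Perm (Fin n)}
    {s : Finset (Fin n)} (hs : IsIncSubseq p s) (hne : s.Nonempty) :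
    s ⊆ insert (s.min' hne) (largerToRight p (s.min' hne)) := by
  intro y hy
  have h1 := s.min'_le y hy
  have h2 := hs _ (s.min'_mem hne) y hy
  simp only [largerToRight, Finset.mem_insert, Finset.mem_filter, Finset.mem_univ, true_and]
  grind

theorem hasULIS_iff_of_avoids {n : ℕ} (hn : 1 ≤ n) {p : Equiv.Perm (Fin n)}
    (hp : Avoids pattern132 p) :
    HasULIS p ↔
      ∃ x, ∀ y, y ≠ x → (largerToRight p y).card < (largerToRight p x).card := by
  constructor
  · rintro ⟨s, ⟨hs, hmax⟩, huniq⟩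
    have hne : s.Nonempty := by
      rw [← Finset.card_pos]
      have := hmax _ (isIncSubseq_insert_largerToRight hp ⟨0, hn⟩)
      rw [card_insert_largerToRight] at this
      omega
    have hsub := hs.subset_insert_largerToRight hne
    have heq := Finset.eq_of_subset_of_card_le hsub
      (hmax _ (isIncSubseq_insert_largerToRight hp _))
    refine ⟨s.min' hne, fun y hy => ?_⟩
    have h1 := hmax _ (isIncSubseq_insert_largerToRight hp y)
    have h2 := card_insert_largerToRight p (s.min' hne)
    rw [← heq] at h2
    rw [card_insert_largerToRight] at h1
    refine lt_of_le_of_ne (by omega) fun h => hy ?_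
    have h3 := huniq (insert y (largerToRight p y)) ⟨isIncSubseq_insert_largerToRight hp y,
      fun t ht => (hmax t ht).trans (by rw [card_insert_largerToRight]; omega)⟩
    have h4 : s.min' hne ∈ insert y (largerToRight p y) := h3 ▸ s.min'_mem hne
    have h5 : s.min' hne ≤ y := s.min'_le y (h3 ▸ Finset.mem_insert_self _ _)
    simp only [largerToRight, Finset.mem_insert, Finset.mem_filter, Finset.mem_univ,
      true_and] at h4
    grind
  · rintro ⟨x, hx⟩
    have hle : ∀ y, (largerToRight p y).card ≤ (largerToRight p x).card := fun y => by
      by_cases h : y = x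
      · rw [h]
      · exact (hx y h).le
    refine ⟨insert x (largerToRight p x), ⟨isIncSubseq_insert_largerToRight hp x, fun t ht => ?_⟩,
      fun t ⟨ht, hmax⟩ => ?_⟩
    · rcases t.eq_empty_or_nonempty with rfl | hne
      · simp
      · refine (Finset.card_le_card (ht.subset_insert_largerToRight hne)).trans ?_
        rw [card_insert_largerToRight, card_insert_largerToRight]
        exact Nat.succ_le_succ (hle _)
    · have h1 := hmax _ (isIncSubseq_insert_largerToRight hp x)
      rw [card_insert_largerToRight] at h1
      have hne : t.Nonempty := by
        rw [← Finset.card_pos]; omega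
      have hsub := ht.subset_insert_largerToRight hne
      have h2 := Finset.card_le_card hsub
      rw [card_insert_largerToRight] at h2
      have h3 : t.min' hne = x := by
        by_contra h
        have := hx _ h
        omega
      rw [h3] at hsub
      exact Finset.eq_of_subset_of_card_le hsub (by rw [card_insert_largerToRight]; exact h1)

/-- The points before time `k` that are fixed or matched to a point at time `k` or later. -/
def openAt {n : ℕ} (τ : Equiv.Perm (Fin n)) (k : ℕ) : Finset (Fin n) :=
  Finset.univ.filter fun s => s.val < k ∧ (τ s = s ∨ k ≤ (τ s).val)

theorem mem_openAt {n : ℕ} {τ : Equiv.Perm (Fin n)} {k : ℕ} {s : Fin n} :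
    s ∈ openAt τ k ↔ s.val < k ∧ (τ s = s ∨ k ≤ (τ s).val) := by
  simp [openAt]

theorem IsOpenMatching.card_openAt_succ {n : ℕ} {τ : Equiv.Perm (Fin n)} (hτ : IsOpenMatching τ)
    (t : Fin n) :
    ((openAt τ (t + 1)).card : ℤ) = (openAt τ t).card + if τ t < t then -1 else 1 := by
  have hinv := hτ.invol
  have hinj : ∀ s, τ s = t → s = τ t := fun s h => by rw [← h, hinv]
  split_ifs with h
  · have : openAt τ t = insert (τ t) (openAt τ (t + 1)) := by
      ext s
      rw [Finset.mem_insert, mem_openAt, mem_openAt]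
      have h1 := hinj s
      have h2 := hinv t
      simp only [Fin.ext_iff, Fin.lt_def] at *
      grind
    rw [this, Finset.card_insert_of_notMem]
    · push_cast; ring
    · rw [mem_openAt, hinv]
      simp only [Fin.ext_iff, Fin.lt_def] at *
      omega
  · have : openAt τ (t + 1) = insert t (openAt τ t) := by
      ext s
      rw [Finset.mem_insert, mem_openAt, mem_openAt]
      have h1 := hinj s
      have h2 := hinv t
      simp only [Fin.ext_iff, Fin.lt_def] at *
      grind
    rw [this, Finset.card_insert_of_notMem]
    · push_cast; ring
    · rw [mem_openAt]; omega

theorem Relabels.card_largerToRight_conj {n : ℕ} {τ p e : Equiv.Perm (Fin n)}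
    (h : Relabels τ p e) (hτ : IsOpenMatching τ) (t : Fin n) :
    (largerToRight p (e (τ t))).card = (largerToRight p (e t)).card := by
  have hp : ∀ x, p (p x) = x := fun x => by
    obtain ⟨t, rfl⟩ := e.surjective x
    rw [← h.conj, ← h.conj, hτ.invol]
  refine Finset.card_bij (fun y _ => p y) ?_ (fun _ _ _ _ h => p.injective h) fun y hy => ?_
  · intro y
    simp only [largerToRight, Finset.mem_filter, Finset.mem_univ, true_and, h.conj, hp]
    exact And.symm
  · refine ⟨p y, ?_, hp y⟩
    simp only [largerToRight, Finset.mem_filter, Finset.mem_univ, true_and, h.conj, hp] at hy ⊢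
    exact hy.symm

theorem Relabels.card_largerToRight {n : ℕ} {τ p e : Equiv.Perm (Fin n)}
    (h : Relabels τ p e) (hτ : IsOpenMatching τ) {t : Fin n} (ht : ¬ τ t < t) :
    (largerToRight p (e t)).card = (openAt τ t).card := by
  symm
  have hinv := hτ.invol
  have key : ∀ s, s ∈ openAt τ t ↔ e s ∈ largerToRight p (e t) := by
    intro s
    simp only [mem_openAt, largerToRight, Finset.mem_filter, Finset.mem_univ, true_and,
      ← h.conj, ← h.lt_iff, ← Fin.lt_def, ← Fin.le_def]
    have h1 := hτ.nested s t
    have h2 := hτ.nested t s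
    have h3 := hτ.nested t (τ s)
    have h4 := hinv s
    have h5 := hinv t
    unfold LabelLT
    grind
  refine Finset.card_bij (fun s _ => e s) (fun s hs => (key s).1 hs)
    (fun _ _ _ _ h => e.injective h) fun y hy => ?_
  obtain ⟨s, rfl⟩ := e.surjective y
  exact ⟨s, (key s).2 hy, rfl⟩

theorem Relabels.hasULIS_iff {n : ℕ} (hn : 1 ≤ n) {τ p e : Equiv.Perm (Fin n)}
    (h : Relabels τ p e) (hτ : IsOpenMatching τ) (hp : Avoids pattern132 p) :
    HasULIS p ↔ ∀ t < n, (openAt τ t).card < (openAt τ n).card := by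
  rw [hasULIS_iff_of_avoids hn hp]
  have hinv := hτ.invol
  constructor
  · rintro ⟨x, hx⟩
    obtain ⟨x, rfl⟩ := e.surjective x
    have hfix : τ x = x := by
      by_contra hne
      have := hx (e (τ x)) (by simpa using hne)
      rw [h.card_largerToRight_conj hτ] at this
      exact lt_irrefl _ this
    have hU : ∀ t : Fin n, ¬ τ t < t → t ≠ x → (openAt τ t).card < (openAt τ x).card := by
      intro t ht hne
      rw [← h.card_largerToRight hτ ht, ← h.card_largerToRight hτ (by simp [hfix])]
      exact hx _ (by simpa using hne)
    have hxn : (openAt τ x).card + 1 ≤ (openAt τ n).card := by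
      have hnot : x ∉ openAt τ x := by simp [mem_openAt]
      rw [← Finset.card_insert_of_notMem hnot]
      refine Finset.card_le_card fun s hs => ?_
      rw [Finset.mem_insert, mem_openAt] at hs
      rw [mem_openAt]
      refine ⟨s.2, Or.inl ?_⟩
      have := hτ.nested s x
      simp only [← Fin.lt_def, ← Fin.le_def] at hs
      grind
    intro t ht
    lift t to Fin n using ht
    by_cases htx : t = x
    · rw [htx]; omega
    · by_cases hD : τ t < t
      · have h1 := hU (τ t) (by rw [hinv]; exact lt_asymm hD) (by
          intro h2
          rw [← h2, hinv] at hfix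
          exact hD.ne hfix.symm)
        have h2 : (openAt τ t).card ≤ (insert (τ t) (openAt τ (τ t))).card := by
          refine Finset.card_le_card fun s hs => ?_
          rw [mem_openAt] at hs
          rw [Finset.mem_insert, mem_openAt]
          have := hτ.nested (τ t) s
          rw [hinv] at this
          simp only [← Fin.lt_def, ← Fin.le_def] at *
          grind
        have h3 := Finset.card_insert_le (τ t) (openAt τ (τ t))
        omega
      · have := hU t hD htx
        omega
  · intro hlt
    let x : Fin n := ⟨n - 1, by omega⟩
    have hxn : x.val + 1 = n := by simp only [x]; omega
    have hstep := hτ.card_openAt_succ x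
    have h1 := hlt x x.2
    rw [hxn] at hstep
    have hx : ¬ τ x < x := fun hx => by
      rw [if_pos hx] at hstep; omega
    rw [if_neg hx] at hstep
    have hfix : τ x = x := by
      have := (τ x).2
      simp only [Fin.lt_def, Fin.ext_iff] at *
      omega
    have hU : ∀ t : Fin n, t ≠ x → ¬ τ t < t →
        (largerToRight p (e t)).card < (largerToRight p (e x)).card := by
      intro t htx ht
      rw [h.card_largerToRight hτ ht, h.card_largerToRight hτ hx]
      have h2 := hτ.card_openAt_succ t
      rw [if_neg ht] at h2
      have h3 := hlt (t + 1) (by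
        have := t.2
        have : t.val ≠ x.val := fun h => htx (Fin.ext h)
        omega)
      omega
    refine ⟨e x, fun y hy => ?_⟩
    obtain ⟨t, rfl⟩ := e.surjective y
    have htx : t ≠ x := fun h => hy (by rw [h])
    by_cases ht : τ t < t
    · rw [← h.card_largerToRight_conj hτ]
      refine hU _ (fun h2 => htx ?_) (by rw [hinv]; exact lt_asymm ht)
      rw [← hinv t, h2, hfix]
    · exact hU t htx ht

/-- The steps of `f` after the first one go down exactly at the right ends of arcs of `τ`. -/
def Encodes {n : ℕ} (τ : Equiv.Perm (Fin n)) (f : Fin (n + 1) → ℤ) : Prop :=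
  f 0 = 1 ∧ ∀ t : Fin n, f t.succ = if τ t < t then -1 else 1

theorem Encodes.word_unique {n : ℕ} {τ : Equiv.Perm (Fin n)} {f g : Fin (n + 1) → ℤ}
    (hf : Encodes τ f) (hg : Encodes τ g) : f = g := by
  ext i
  refine Fin.cases ?_ (fun t => ?_) i
  · rw [hf.1, hg.1]
  · rw [hf.2, hg.2]

theorem Encodes.matching_unique {n : ℕ} {τ τ' : Equiv.Perm (Fin n)} {f : Fin (n + 1) → ℤ}
    (h : Encodes τ f) (h' : Encodes τ' f) (hτ : IsOpenMatching τ) (hτ' : IsOpenMatching τ') :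
    τ = τ' := by
  have hiff : ∀ t, τ t < t ↔ τ' t < t := by
    intro t
    have := (h.2 t).symm.trans (h'.2 t)
    by_cases h1 : τ t < t <;> by_cases h2 : τ' t < t <;> simp [h1, h2] at this ⊢
  have hi := hτ.invol
  have hi' := hτ'.invol
  have hD : ∀ t, τ t < t → τ t = τ' t := by
    intro t
    induction t using WellFoundedLT.induction with
    | ind t ih =>
      intro ht
      have ht' := (hiff t).1 ht
      rcases lt_trichotomy (τ t) (τ' t) with hlt | heq | hlt
      · have h1 := hτ.nested (τ t) (τ' t) hlt (by rw [hi]; exact ht')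
        rw [hi] at h1
        have h2 := hiff (τ' t)
        have h3 := ih (τ (τ' t)) h1.2.2
        have h4 := hi (τ' t)
        have h5 := hi' t
        have h6 := hi' (τ (τ' t))
        grind
      · exact heq
      · have h1 := hτ'.nested (τ' t) (τ t) hlt (by rw [hi']; exact ht)
        rw [hi'] at h1
        have h2 := hiff (τ t)
        have h3 := ih (τ' (τ t)) h1.2.2
        have h4 := hi (τ' (τ t))
        have h5 := hi t
        have h6 := hi' (τ t)
        grind
  ext1 t
  rcases lt_trichotomy (τ t) t with h1 | h1 | h1
  · exact hD t h1
  · by_contra hne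
    have h2 := hiff t
    have h3 := hiff (τ' t)
    have h4 := hD (τ' t)
    have h5 := hi' t
    have h6 := hi (τ' t)
    grind
  · have h2 := hD (τ t) (by rw [hi]; exact h1)
    rw [hi] at h2
    rw [h2, hi', ← h2]

theorem IsOpenMatching.exists_mul_swap {n : ℕ} {τ : Equiv.Perm (Fin n)} (hτ : IsOpenMatching τ)
    (m : Fin n) (hm : ∀ t, m ≤ t → τ t = t) (hne : ∃ s, s < m ∧ τ s = s) :
    ∃ τ' : Equiv.Perm (Fin n), IsOpenMatching τ' ∧ (∀ t, m < t → τ' t = t) ∧ τ' m < m ∧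
      ∀ t, t < m → (τ' t < t ↔ τ t < t) := by
  classical
  obtain ⟨f, hf, hmax⟩ : ∃ f, (f < m ∧ τ f = f) ∧ ∀ s, s < m ∧ τ s = s → s ≤ f := by
    have hne' : (Finset.univ.filter fun s => s < m ∧ τ s = s).Nonempty := by
      obtain ⟨s, hs⟩ := hne
      exact ⟨s, by simpa using hs⟩
    refine ⟨Finset.max' _ hne', ?_, fun s hs => Finset.le_max' _ _ (by simpa using hs)⟩
    simpa using Finset.max'_mem _ hne'
  have hi := hτ.invol
  have hmm := hm m le_rfl
  have hval : ∀ t, (τ * Equiv.swap f m) t = if t = f then m else if t = m then f else τ t := by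
    intro t
    rw [Equiv.Perm.mul_apply, Equiv.swap_apply_def]
    split_ifs <;> simp_all
  refine ⟨τ * Equiv.swap f m, ⟨fun t => ?_, fun a b => ?_⟩, fun t => ?_, ?_, fun t => ?_⟩
  · have := hi t
    rw [hval, hval]
    grind
  · have h1 := hτ.nested a b
    have h2 := hτ.nested (τ b) f
    have h3 := hi b
    have h4 := hm b
    have h5 := hmax b
    have h6 := hi a
    have h7 := hm a
    have h8 := hm (τ b)
    have h9 := hm (τ a)
    rw [hval, hval]
    grind
  · have := hm t
    rw [hval]
    grind
  · rw [hval]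
    grind
  · have := hm t
    rw [hval]
    grind

theorem sum_filter_lt_succ {n : ℕ} (f : Fin (n + 1) → ℤ) (k : Fin (n + 1)) :
    ∑ i with i.val < k.val + 1, f i = ∑ i with i.val < k.val, f i + f k := by
  classical
  have : (Finset.univ.filter fun i : Fin (n + 1) => i.val < k.val + 1)
      = insert k (Finset.univ.filter fun i : Fin (n + 1) => i.val < k.val) := by
    ext i
    simp only [Finset.mem_insert, Finset.mem_filter, Finset.mem_univ, true_and, Fin.ext_iff]
    omega
  rw [this, Finset.sum_insert (by simp)]
  ring

theorem sum_filter_lt_eq_card_openAt {n : ℕ} {τ : Equiv.Perm (Fin n)} (hτ : IsOpenMatching τ)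
    {f : Fin (n + 1) → ℤ} (h0 : f 0 = 1) {k : ℕ} (hk : k ≤ n)
    (hf : ∀ t : Fin n, t.val < k → f t.succ = if τ t < t then -1 else 1) :
    ∑ i with i.val < k + 1, f i = 1 + (openAt τ k).card := by
  induction k with
  | zero =>
    have := sum_filter_lt_succ f 0
    simpa [openAt, h0] using this
  | succ k ih =>
    have h1 := sum_filter_lt_succ f (Fin.succ ⟨k, hk⟩)
    rw [hf ⟨k, hk⟩ (by simp)] at h1
    have h2 := hτ.card_openAt_succ ⟨k, hk⟩
    simp only [Fin.val_succ] at h1 h2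
    rw [h1, ih (by omega) fun t ht => hf t (by omega), h2]
    ring

theorem exists_isOpenMatching_encodes {n : ℕ} {f : Fin (n + 1) → ℤ}
    (hf : ∀ i, f i = 1 ∨ f i = -1) (hpos : ∀ k : Fin (n + 1), 0 < ∑ i ∈ Finset.Iic k, f i) :
    ∃ τ : Equiv.Perm (Fin n), IsOpenMatching τ ∧ Encodes τ f := by
  have hpre : ∀ k, k ≤ n → 0 < ∑ i with i.val < k + 1, f i := by
    intro k hk
    convert hpos ⟨k, by omega⟩ using 2
    ext i
    simp only [Finset.mem_filter, Finset.mem_univ, true_and, Finset.mem_Iic, Fin.le_def]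
    omega
  have h0 : f 0 = 1 := by
    have h1 := hpre 0 (by omega)
    have h2 := sum_filter_lt_succ f 0
    have := hf 0
    simp at h1 h2
    omega
  have key : ∀ k, k ≤ n → ∃ τ : Equiv.Perm (Fin n), IsOpenMatching τ ∧
      (∀ t : Fin n, k ≤ t.val → τ t = t) ∧
      ∀ t : Fin n, t.val < k → f t.succ = if τ t < t then -1 else 1 := by
    intro k
    induction k with
    | zero =>
      refine fun _ => ⟨1, ⟨by simp, fun a b h1 h2 => ?_⟩, by simp, by simp⟩
      exact absurd (h1.trans h2) (lt_irrefl _)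
    | succ k ih =>
      intro hk
      obtain ⟨τ, hτ, hfix, henc⟩ := ih (by omega)
      have hsum := sum_filter_lt_eq_card_openAt hτ h0 (by omega) henc
      have hstep := sum_filter_lt_succ f (Fin.succ ⟨k, hk⟩)
      have hp := hpre (k + 1) hk
      simp only [Fin.val_succ] at hstep
      rcases hf (Fin.succ ⟨k, hk⟩) with h1 | h1
      · refine ⟨τ, hτ, fun t ht => hfix t (by omega), fun t ht => ?_⟩
        by_cases htk : t.val < k
        · exact henc t htk
        · obtain rfl : t = ⟨k, hk⟩ := Fin.ext (by simp only; omega)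
          rw [h1, hfix _ le_rfl]
          simp
      · have hne : (openAt τ k).Nonempty := by
          rw [← Finset.card_pos]
          omega
        obtain ⟨s, hs⟩ := hne
        rw [mem_openAt] at hs
        obtain ⟨τ', hτ', hfix', hdown, hiff⟩ := hτ.exists_mul_swap ⟨k, hk⟩
          (fun t ht => hfix t ht) ⟨s, hs.1, by
            rcases hs.2 with h2 | h2
            · exact h2
            · have := hfix _ h2
              exact τ.injective this⟩
        refine ⟨τ', hτ', fun t ht => hfix' t ht, fun t ht => ?_⟩
        by_cases htk : t.val < k
        · rw [henc t htk]
          simp only [hiff t htk]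
        · obtain rfl : t = ⟨k, hk⟩ := Fin.ext (by simp only; omega)
          rw [h1, if_pos hdown]
  obtain ⟨τ, hτ, -, henc⟩ := key n le_rfl
  exact ⟨τ, hτ, h0, fun t => henc t t.2⟩

theorem Encodes.sum_Iic {n : ℕ} {τ : Equiv.Perm (Fin n)} {f : Fin (n + 1) → ℤ}
    (h : Encodes τ f) (hτ : IsOpenMatching τ) (k : Fin (n + 1)) :
    ∑ i ∈ Finset.Iic k, f i = 1 + (openAt τ k).card := by
  rw [← sum_filter_lt_eq_card_openAt hτ h.1 (by omega) fun t _ => h.2 t]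
  congr 1
  ext i
  simp only [Finset.mem_filter, Finset.mem_univ, true_and, Finset.mem_Iic, Fin.le_def]
  omega

theorem Encodes.suffix_pos_iff {n : ℕ} {τ : Equiv.Perm (Fin n)} {f : Fin (n + 1) → ℤ}
    (h : Encodes τ f) (hτ : IsOpenMatching τ) :
    (∀ k : Fin (n + 1), 0 < ∑ i ∈ Finset.Ici k, f i) ↔
      ∀ t < n, (openAt τ t).card < (openAt τ n).card := by
  have htot : ∑ i, f i = 1 + (openAt τ n).card := by
    have h1 := h.sum_Iic hτ (Fin.last n)
    have h2 : Finset.Iic (Fin.last n) = Finset.univ := by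
      ext i
      simp [Fin.le_last]
    rwa [h2] at h1
  have hsuf : ∀ t : Fin n, ∑ i ∈ Finset.Ici t.succ, f i
      = (openAt τ n).card - (openAt τ t).card := by
    intro t
    have h1 := h.sum_Iic hτ t.castSucc
    have h2 : (Finset.Iic t.castSucc)ᶜ = Finset.Ici t.succ := by
      ext i
      simp [Fin.le_def]
    have h3 := Finset.sum_add_sum_compl (Finset.Iic t.castSucc) f
    rw [h2, h1, htot] at h3
    simp only [Fin.val_castSucc] at h3
    linarith
  constructor
  · intro hp t ht
    have h1 := hp (Fin.succ ⟨t, ht⟩)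
    rw [hsuf] at h1
    simp only at h1
    omega
  · intro hlt k
    refine Fin.cases ?_ (fun t => ?_) k
    · have : Finset.Ici (0 : Fin (n + 1)) = Finset.univ := by ext i; simp
      rw [this, htot]
      positivity
    · rw [hsuf]
      have := hlt t t.2
      omega

/-- For every `n ≥ 1`, the number of 132-avoiding involutions of length `n` with a
unique longest increasing subsequence equals the number of bidirectional ballot
sequences of length `n+1`: sequences of `n+1` steps `±1` in which every nonempty
prefix and every nonempty suffix has strictly positive sum. -/
theorem i132_eq_bidirectional_ballot (n : ℕ) (hn : 1 ≤ n) :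
    Nat.card {p : Equiv.Perm (Fin n) // p⁻¹ = p ∧ Avoids pattern132 p ∧ HasULIS ⇑p}
      = Nat.card {f : Fin (n + 1) → ℤ //
          (∀ i, f i = 1 ∨ f i = -1) ∧
          (∀ k : Fin (n + 1), 0 < ∑ i ∈ Finset.Iic k, f i) ∧
          (∀ k : Fin (n + 1), 0 < ∑ i ∈ Finset.Ici k, f i)} := by
  refine card_eq_of_rel
    (fun p f => ∃ τ e, Relabels τ p.1 e ∧ IsOpenMatching τ ∧ Encodes τ f.1) ?_ ?_ ?_ ?_
  · rintro ⟨p, hinv, hav, hu⟩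
    obtain ⟨τ, e, h, hτ⟩ := exists_relabels_of_avoids hinv hav
    obtain ⟨f, henc⟩ : ∃ f, Encodes τ f :=
      ⟨Fin.cons 1 fun t => if τ t < t then -1 else 1, Fin.cons_zero _ _,
        fun t => Fin.cons_succ _ _ _⟩
    refine ⟨⟨f, fun i => ?_, fun k => ?_, ?_⟩, τ, e, h, hτ, henc⟩
    · refine Fin.cases ?_ (fun t => ?_) i
      · exact Or.inl henc.1
      · rw [henc.2]
        split_ifs <;> simp
    · rw [henc.sum_Iic hτ]
      positivity
    · exact (henc.suffix_pos_iff hτ).2 ((h.hasULIS_iff hn hτ hav).1 hu)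
  · rintro ⟨f, hf, hpre, hsuf⟩
    obtain ⟨τ, hτ, henc⟩ := exists_isOpenMatching_encodes hf hpre
    obtain ⟨p, e, h, hinv, hav⟩ := exists_relabels_of_isOpenMatching hτ
    exact ⟨⟨p, hinv, hav, (h.hasULIS_iff hn hτ hav).2 ((henc.suffix_pos_iff hτ).1 hsuf)⟩,
      τ, e, h, hτ, henc⟩
  · rintro p f g ⟨τ, e, h, hτ, henc⟩ ⟨τ', e', h', hτ', henc'⟩
    obtain rfl := h.matching_unique h' hτ hτ'
    exact Subtype.ext (henc.word_unique henc')
  · rintro p p' f ⟨τ, e, h, hτ, henc⟩ ⟨τ', e', h', hτ', henc'⟩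
    obtain rfl := henc.matching_unique henc' hτ hτ'
    exact Subtype.ext (h.perm_unique h')
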